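/- arXiv:1403.6402 — 2 statements merged into one kernel-verified Lean document; each statement's English description precedes it below -/
import Mathlib

section
/- Let c1sq, c2, b1, b2, m, T, q, h01, pg, chi, h11, m02, m20 be integers satisfying h11 = m − 2·T, 6·(h11 − b1) = 5·c2 − c1sq, b2 = h11 + 2·pg, b2 = m02 + m + m20, m02 ≥ 0, m20 ≥ 0, b1 = 2·q, q ≤ h01, chi = 1 − h01 + pg, Noether's formula 12·chi = c1sq + c2, c1sq > 0, c2 > 0, and m ≥ 4·pg. Then c1sq ≤ 5·c2. -/
theorem stmt_6 (c1sq c2 b1 b2 m T q h01 pg chi h11 m02 m20 : ℤ)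
    (h1 : h11 = m - 2 * T)
    (h2 : 6 * (h11 - b1) = 5 * c2 - c1sq)
    (h3 : b2 = h11 + 2 * pg)
    (h4 : b2 = m02 + m + m20)
    (h5 : m02 ≥ 0)
    (h6 : m20 ≥ 0)
    (h7 : b1 = 2 * q)
    (h8 : q ≤ h01)
    (h9 : chi = 1 - h01 + pg)
    (hNoether : 12 * chi = c1sq + c2)
    (hc1 : c1sq > 0)
    (hc2 : c2 > 0)
    (hm : m ≥ 4 * pg) :
    c1sq ≤ 5 * c2 := by
  omega
end

section
/- Let m : ℚ → ℕ be a finitely supported function with m(λ) = 0 unless 0 ≤ λ ≤ 2, satisfying the symmetry m(λ) = m(2 − λ) for all λ ∈ ℚ, and with m(λ) = 0 for 0 < λ < 1/2. Let p ∈ ℚ with p ≥ 0. If m(1) ≥ 1 and Σ_{0 < λ < 1} (1−λ)·m(λ) ≥ p, then Σ_{0 ≤ λ < 1} λ·m(λ) + Σ_{1 ≤ λ < 2} (2−λ)·m(λ) ≥ 1 + 2·p > 2·p, where all sums are finite sums in ℚ over the support of m. -/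
open Finset

theorem stmt_12 (m : ℚ →₀ ℕ) (p : ℚ)
    (hrange : ∀ lam : ℚ, m lam ≠ 0 → 0 ≤ lam ∧ lam ≤ 2)
    (hsym : ∀ lam : ℚ, m lam = m (2 - lam))
    (hslope : ∀ lam : ℚ, 0 < lam → lam < 1 / 2 → m lam = 0)
    (hp : 0 ≤ p)
    (hm1 : 1 ≤ m 1)
    (hsum : (∑ lam ∈ m.support.filter (fun l => 0 < l ∧ l < 1), (1 - lam) * (m lam : ℚ)) ≥ p) :
    (∑ lam ∈ m.support.filter (fun l => 0 ≤ l ∧ l < 1), lam * (m lam : ℚ))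
          + (∑ lam ∈ m.support.filter (fun l => 1 ≤ l ∧ l < 2), (2 - lam) * (m lam : ℚ))
        ≥ 1 + 2 * p
      ∧ (1 : ℚ) + 2 * p > 2 * p := by
  have hcompare : ∑ l ∈ m.support.filter (fun l => 0 < l ∧ l < 1), (1 - l) * (m l : ℚ) ≤
      ∑ l ∈ m.support.filter (fun l => 0 < l ∧ l < 1), l * (m l : ℚ) := by
    refine sum_le_sum fun l hl => ?_
    simp only [mem_filter, Finsupp.mem_support_iff] at hl
    have hhalf : 1 / 2 ≤ l := not_lt.mp fun h => hl.1 (hslope l hl.2.1 h)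
    exact mul_le_mul_of_nonneg_right (by linarith) (Nat.cast_nonneg _)
  have hlow : ∑ l ∈ m.support.filter (fun l => 0 < l ∧ l < 1), l * (m l : ℚ) ≤
      ∑ l ∈ m.support.filter (fun l => 0 ≤ l ∧ l < 1), l * (m l : ℚ) :=
    sum_le_sum_of_subset_of_nonneg (monotone_filter_right _ fun l _ hl => ⟨hl.1.le, hl.2⟩)
      fun l hl _ => mul_nonneg (mem_filter.mp hl).2.1 (Nat.cast_nonneg _)
  have hreflect : ∑ l ∈ m.support.filter (fun l => 1 < l ∧ l < 2), (2 - l) * (m l : ℚ) =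
      ∑ l ∈ m.support.filter (fun l => 0 < l ∧ l < 1), l * (m l : ℚ) := by
    refine sum_nbij' (fun l => 2 - l) (fun l => 2 - l) ?_ ?_ ?_ ?_ ?_
    · intro l hl
      simp only [mem_filter, Finsupp.mem_support_iff, ← hsym l] at hl ⊢
      exact ⟨hl.1, by linarith, by linarith⟩
    · intro l hl
      simp only [mem_filter, Finsupp.mem_support_iff, ← hsym l] at hl ⊢
      exact ⟨hl.1, by linarith, by linarith⟩
    · simp
    · simp
    · intro l _
      rw [← hsym l]
  have hsplit : m.support.filter (fun l => 1 ≤ l ∧ l < 2) =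
      insert 1 (m.support.filter (fun l => 1 < l ∧ l < 2)) := by
    ext l
    simp only [mem_filter, mem_insert, Finsupp.mem_support_iff]
    constructor
    · rintro ⟨h, h1, h2⟩
      exact h1.eq_or_lt.imp Eq.symm fun h1 => ⟨h, h1, h2⟩
    · rintro (rfl | ⟨h, h1, h2⟩)
      · exact ⟨by omega, le_rfl, by norm_num⟩
      · exact ⟨h, h1.le, h2⟩
  have hone : (1 : ℚ) ≤ m 1 := by exact_mod_cast hm1
  rw [hsplit, sum_insert (by simp), hreflect]
  constructor <;> linarith
end
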